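/- (Wick/Pfaffian formula for vacuum expectation values.) Let v_1, …, v_{2n} be operators on B = ℂ[t_1,t_3,t_5,…], each of the form v_i = Σ_{j∈ℤ} a_{ij} φ̂_j with a_{ij} ∈ ℂ and a_{ij} = 0 for all sufficiently negative j (so that v_i p is a well-defined polynomial for every p). Then ev_0(v_1 v_2 ⋯ v_{2n} · 1) = Pf(M), where M is the 2n×2n skew-symmetric matrix whose (i,j) entry for i < j is ev_0(v_i v_j · 1). -/

import Mathlib

/- ## Setup: the ring `B = ℂ[t₁,t₃,t₅,…]`, elementary Schur polynomials,
   vertex-operator coefficients, and the BKP bilinear identity. -/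

noncomputable section

open MvPolynomial

/-- The polynomial ring `B = ℂ[t₁,t₃,t₅,…]`; variable `i` represents `t_{2i+1}`. -/
abbrev BRing : Type := MvPolynomial ℕ ℂ

/-- The universal elementary Schur polynomials `s_n`, defined by
`exp (∑_{j≥1} t_j z^j) = ∑_{n≥0} s_n(t) z^n`; here the variable `j` (for `j ≥ 1`)
represents `t_j`.  They satisfy `s_0 = 1` and `(n+1) s_{n+1} = ∑_{j=1}^{n+1} j t_j s_{n+1-j}`. -/
def schurPoly : ℕ → MvPolynomial ℕ ℂ
  | 0 => 1
  | n + 1 =>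
      ((n + 1 : ℂ))⁻¹ •
        ∑ j ∈ Finset.range (n + 1),
          ((j + 1 : ℂ)) • (MvPolynomial.X (j + 1) * schurPoly (n - j))
  termination_by n => n
  decreasing_by omega

/-- `s_n(c)` for a complex sequence `c = (c_1, c_2, …)` (the entry `c 0` is ignored). -/
def sC (n : ℕ) (c : ℕ → ℂ) : ℂ := MvPolynomial.eval c (schurPoly n)

/-- `s_n` evaluated on a sequence of elements of `B`. -/
def sB (n : ℕ) (c : ℕ → BRing) : BRing := MvPolynomial.aeval c (schurPoly n)

/-- The sequence `t̃ = (t₁, 0, t₃, 0, t₅, 0, …)` of elements of `B`. -/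
def tTilde : ℕ → BRing := fun j => if j % 2 = 1 then MvPolynomial.X ((j - 1) / 2) else 0

/-- The sequence `t̃ + c` for a constant sequence `c`. -/
def tShift (c : ℕ → ℂ) : ℕ → BRing := fun j => tTilde j + MvPolynomial.C (c j)

/-- `s̃_m = s_m(t̃) ∈ B` for `m ≥ 0`, and `0` for `m < 0`; these are the coefficients of
`exp (∑_{j>0 odd} t_j z^j)`. -/
def sTildeZ (m : ℤ) : BRing :=
  if 0 ≤ m then MvPolynomial.aeval tTilde (schurPoly m.toNat) else 0

/-- `s_m(-t̃) ∈ B` for `m ≥ 0`, and `0` for `m < 0`; the coefficients of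
`exp (-∑_{j>0 odd} t_j z^j)`. -/
def sTildeNegZ (m : ℤ) : BRing :=
  if 0 ≤ m then MvPolynomial.aeval (fun j => -(tTilde j)) (schurPoly m.toNat) else 0

/-- `p(t₁ - 2w, t₃ - (2/3)w³, t₅ - (2/5)w⁵, …)` as a polynomial in `w` (which stands for
`z⁻¹`) over `B`: this is `exp (-2∑_{j>0 odd} (1/j) ∂/∂t_j z^{-j}) p` by Taylor's formula. -/
def shiftMinus (p : BRing) : Polynomial BRing :=
  MvPolynomial.aeval
    (fun i => Polynomial.C (MvPolynomial.X i) -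
      Polynomial.C (MvPolynomial.C ((2 : ℂ) / ((2 * i + 1 : ℕ) : ℂ))) *
        Polynomial.X ^ (2 * i + 1)) p

/-- `p(t₁ + 2w, t₃ + (2/3)w³, …)`, i.e. `exp (2∑_{j>0 odd} (1/j) ∂/∂t_j z^{-j}) p`. -/
def shiftPlus (p : BRing) : Polynomial BRing :=
  MvPolynomial.aeval
    (fun i => Polynomial.C (MvPolynomial.X i) +
      Polynomial.C (MvPolynomial.C ((2 : ℂ) / ((2 * i + 1 : ℕ) : ℂ))) *
        Polynomial.X ^ (2 * i + 1)) p

/-- The coefficient of `z^m` in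
`exp (∑_{j>0 odd} t_j z^j) exp (-2∑_{j>0 odd} (1/j)(∂/∂t_j) z^{-j}) τ`. -/
def leftCoeff (τ : BRing) (m : ℤ) : BRing :=
  ∑ᶠ k : ℕ, sTildeZ (m + k) * (shiftMinus τ).coeff k

/-- The coefficient of `z^m` in
`exp (-∑_{j>0 odd} t_j z^j) exp (2∑_{j>0 odd} (1/j)(∂/∂t_j) z^{-j}) τ`. -/
def rightCoeff (τ : BRing) (m : ℤ) : BRing :=
  ∑ᶠ k : ℕ, sTildeNegZ (m + k) * (shiftPlus τ).coeff k

/-- `ℂ[t₁,t₃,…] ⊗ ℂ[t'₁,t'₃,…]`, realized as polynomials in two families of variables. -/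
abbrev BRing2 : Type := MvPolynomial (ℕ ⊕ ℕ) ℂ

/-- The embedding `p(t) ↦ p(t) ∈ ℂ[t] ⊗ ℂ[t']` on the first factor. -/
def inL : BRing →+* BRing2 := (MvPolynomial.rename Sum.inl).toRingHom

/-- The embedding `p(t') ↦ p(t') ∈ ℂ[t] ⊗ ℂ[t']` on the second factor. -/
def inR : BRing →+* BRing2 := (MvPolynomial.rename Sum.inr).toRingHom

/-- The BKP bilinear identity on `τ ∈ ℂ[t₁,t₃,t₅,…]`: the coefficient of `z⁰` in
`(exp(∑ t_j z^j) exp(-2∑ (1/j)∂_{t_j} z^{-j}) τ)(t) ·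
 (exp(-∑ t'_j z^j) exp(2∑ (1/j)∂_{t'_j} z^{-j}) τ)(t')`
equals `τ(t) τ(t')` (all sums over odd `j > 0`; only finitely many summands below
are nonzero since `τ` is a polynomial). -/
def SatisfiesBKP (τ : BRing) : Prop :=
  ∑ᶠ m : ℤ, inL (leftCoeff τ m) * inR (rightCoeff τ (-m)) = inL τ * inR τ

/-- The MDKP bilinear identity on a pair `(τ₀, τ₁)`. -/
def SatisfiesMDKP (τ₀ τ₁ : BRing) : Prop :=
  ∑ᶠ m : ℤ, inL (leftCoeff τ₀ m) * inR (rightCoeff τ₁ (-m)) = inL τ₁ * inR τ₀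

/-- The condition on a permutation `σ` appearing in the definition of the Pfaffian:
`σ(2i-1) < σ(2i)` for all `i`, and `σ(1) < σ(3) < ⋯` (with 0-based indices here). -/
def pfaffianCond {m : ℕ} (σ : Equiv.Perm (Fin m)) : Prop :=
  (∀ i : Fin (m / 2),
      σ ⟨2 * i.val, by have := i.isLt; omega⟩ < σ ⟨2 * i.val + 1, by have := i.isLt; omega⟩) ∧
  (∀ i j : Fin (m / 2), i < j →
      σ ⟨2 * i.val, by have := i.isLt; omega⟩ < σ ⟨2 * j.val, by have := j.isLt; omega⟩)

open scoped Classical in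
/-- The Pfaffian `Pf(A) = ∑_σ sgn(σ) ∏_i a_{σ(2i-1),σ(2i)}` of a (skew-symmetric) matrix;
it is intended to be used for matrices of even size `m = 2n`. -/
def pfaffian {R : Type*} [CommRing R] {m : ℕ} (A : Matrix (Fin m) (Fin m) R) : R :=
  ∑ σ : Equiv.Perm (Fin m),
    if pfaffianCond σ then
      (Equiv.Perm.sign σ : ℤ) •
        ∏ i : Fin (m / 2),
          A (σ ⟨2 * i.val, by have := i.isLt; omega⟩)
            (σ ⟨2 * i.val + 1, by have := i.isLt; omega⟩)
    else 0

/-- The skew-symmetric matrix with `(i,j)`-entry `f i j` for `i < j`. -/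
def skewOf {R : Type*} [CommRing R] {m : ℕ} (f : Fin m → Fin m → R) :
    Matrix (Fin m) (Fin m) R :=
  Matrix.of fun i j => if i < j then f i j else if j < i then -f j i else 0

/-- `χ_{λ,μ}(c,c') = (1/2) s_λ(c) s_μ(c') + ∑_{ℓ=1}^{μ} (-1)^ℓ s_{λ+ℓ}(c) s_{μ-ℓ}(c')`,
for `λ > μ ≥ 0` and sequences `c, c'` of elements of `B`. -/
def chiB (l μ : ℕ) (c c' : ℕ → BRing) : BRing :=
  (2 : ℂ)⁻¹ • (sB l c * sB μ c') +
    ∑ ℓ ∈ Finset.Icc 1 μ, ((-1 : ℂ) ^ ℓ) • (sB (l + ℓ) c * sB (μ - ℓ) c')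

/-- The skew-symmetric matrix `( χ_{λ_i,λ_j}(t̃+c_i, t̃+c_j) )_{i,j}`. -/
def chiMatrix {m : ℕ} (lam : Fin m → ℕ) (c : Fin m → ℕ → ℂ) :
    Matrix (Fin m) (Fin m) BRing :=
  skewOf fun i j => chiB (lam i) (lam j) (tShift (c i)) (tShift (c j))

/-- `√2` as a complex number. -/
def sqrt2 : ℂ := (Real.sqrt 2 : ℂ)

/-- `ρ_{λ,μ}(c,c';b,b') = (s_λ(c)/√2 - b)(s_μ(c')/√2 + b')
  + ∑_{ℓ=1}^{μ} (-1)^ℓ s_{λ+ℓ}(c) s_{μ-ℓ}(c')` for `λ > μ ≥ 0`. -/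
def rhoB (l μ : ℕ) (c c' : ℕ → BRing) (b b' : ℂ) : BRing :=
  (sqrt2⁻¹ • sB l c - MvPolynomial.C b) * (sqrt2⁻¹ • sB μ c' + MvPolynomial.C b') +
    ∑ ℓ ∈ Finset.Icc 1 μ, ((-1 : ℂ) ^ ℓ) • (sB (l + ℓ) c * sB (μ - ℓ) c')

/-- `ρ_λ(c;b) = s_λ(c)/√2 + b`. -/
def rho1B (l : ℕ) (c : ℕ → BRing) (b : ℂ) : BRing :=
  sqrt2⁻¹ • sB l c + MvPolynomial.C b

/-- The `2n × 2n` skew-symmetric matrix `( ρ_{λ_i,λ_j}(t̃+c_i, t̃+c_j; b_i, b_j) )_{i,j}`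
(for an even number `m = 2n` of rows of `λ`). -/
def rhoMatrixEven {m : ℕ} (lam : Fin m → ℕ) (c : Fin m → ℕ → ℂ) (b : Fin m → ℂ) :
    Matrix (Fin m) (Fin m) BRing :=
  skewOf fun i j => rhoB (lam i) (lam j) (tShift (c i)) (tShift (c j)) (b i) (b j)

/-- For an odd number `m` of parts `λ_1 > ⋯ > λ_m ≥ 0`, the `(m+1) × (m+1)`
skew-symmetric matrix with rows/columns indexed by `0, 1, …, m`, whose `(0,j)`-entry is
`ρ_{λ_j}(t̃+c_j; b_j)` and whose `(i,j)`-entry for `1 ≤ i < j` is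
`ρ_{λ_i,λ_j}(t̃+c_i, t̃+c_j; b_i, b_j)`. -/
def rhoMatrixOdd {m : ℕ} (lam : Fin m → ℕ) (c : Fin m → ℕ → ℂ) (b : Fin m → ℂ) :
    Matrix (Fin (m + 1)) (Fin (m + 1)) BRing :=
  skewOf fun i j =>
    if i.val = 0 then
      if hj : j.val = 0 then 0
      else
        rho1B (lam ⟨j.val - 1, by have := j.isLt; omega⟩)
          (tShift (c ⟨j.val - 1, by have := j.isLt; omega⟩))
          (b ⟨j.val - 1, by have := j.isLt; omega⟩)
    else
      if hj : j.val = 0 then 0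
      else
        rhoB (lam ⟨i.val - 1, by have := i.isLt; omega⟩)
          (lam ⟨j.val - 1, by have := j.isLt; omega⟩)
          (tShift (c ⟨i.val - 1, by have := i.isLt; omega⟩))
          (tShift (c ⟨j.val - 1, by have := j.isLt; omega⟩))
          (b ⟨i.val - 1, by have := i.isLt; omega⟩)
          (b ⟨j.val - 1, by have := j.isLt; omega⟩)

/-- The DKP tau-function `ρ_λ(t̃; c_1,…,c_k; b_1,…,b_k)` attached to an extended strict
partition `λ` with `k` parts: a Pfaffian of size `k` if `k` is even, and of size `k+1`
(with an extra 0-th row built from the `ρ_{λ_j}`) if `k` is odd. -/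
def rhoTau {k : ℕ} (lam : Fin k → ℕ) (c : Fin k → ℕ → ℂ) (b : Fin k → ℂ) : BRing :=
  if k % 2 = 0 then pfaffian (rhoMatrixEven lam c b)
  else pfaffian (rhoMatrixOdd lam c b)

/-- The operators `φ̂_j` (`j ∈ ℤ`) on `B`, defined by the generating series
`∑_{j∈ℤ} φ̂_j z^{-j} = (1/√2) exp(∑_{k>0 odd} t_k z^k) exp(-∑_{k>0 odd} (2/k) ∂_{t_k} z^{-k})`. -/
def phiHat (j : ℤ) (p : BRing) : BRing :=
  sqrt2⁻¹ • ∑ᶠ k : ℕ, sTildeZ ((k : ℤ) - j) * (shiftMinus p).coeff k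

/-- `a : ℤ → ℂ` vanishes for all sufficiently negative indices. -/
def BddBelowSupport (a : ℤ → ℂ) : Prop := ∃ N : ℤ, ∀ j < N, a j = 0

/-- The operator `v = ∑_{j∈ℤ} a_j φ̂_j` on `B` (a finite sum on each polynomial,
when `a` has support bounded below). -/
def vOp (a : ℤ → ℂ) (p : BRing) : BRing := ∑ᶠ j : ℤ, a j • phiHat j p

/-- Evaluation at `t = 0`, `ev₀ : B → ℂ` (the vacuum expectation value). -/
def ev0 : BRing → ℂ := MvPolynomial.eval (fun _ => 0)

/-- The "`√2` times `φ̂_j`" vertex operator coefficients (without the `1/√2` factor),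
used for the type `D` construction. -/
def vertexB (j : ℤ) (p : BRing) : BRing :=
  ∑ᶠ k : ℕ, sTildeZ ((k : ℤ) - j) * (shiftMinus p).coeff k

/-- `B_D = ℂ[θ] ⊗ B` with `θ` a Grassmann variable: the pair `(p₀, p₁)` represents
`p₀ + θ p₁`. -/
abbrev BD : Type := BRing × BRing

/-- The operators `Φ̂_j` (`j ∈ ℤ`) on `B_D`, defined by
`∑_j Φ̂_j z^{-j} = (1/√2)(θ + ∂/∂θ) exp(∑ t_k z^k) exp(-∑ (2/k) ∂_{t_k} z^{-k})`. -/
def PhiHatD (j : ℤ) (p : BD) : BD :=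
  sqrt2⁻¹ • (vertexB j p.2, vertexB j p.1)

/-- `Ψ = (θ - ∂/∂θ)/√2` on `B_D`. -/
def PsiD (p : BD) : BD := sqrt2⁻¹ • (-p.2, p.1)

/-- The type `D` fermions `φ̂_a`, `a ∈ ½ + ℤ`, where the integer `m` encodes the
half-integer index `a = m + ½`:  `φ̂_{-i-½} = Φ̂_{-i}` and `φ̂_{i+½} = (-1)^i Φ̂_i`
for `i ≥ 1`, `φ̂_{-½} = (Φ̂_0 + Ψ)/√2`, `φ̂_{½} = (Φ̂_0 - Ψ)/√2`. -/
def phiD (m : ℤ) (p : BD) : BD :=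
  if m ≤ -2 then PhiHatD (m + 1) p
  else if m = -1 then sqrt2⁻¹ • (PhiHatD 0 p + PsiD p)
  else if m = 0 then sqrt2⁻¹ • (PhiHatD 0 p - PsiD p)
  else ((-1 : ℂ) ^ m) • PhiHatD m p

end

noncomputable section

section SchurGen
variable {R : Type*} [CommRing R] [Algebra ℂ R]

def sch (c : ℕ → R) (n : ℕ) : R := MvPolynomial.aeval c (schurPoly n)

lemma sch_zero (c : ℕ → R) : sch c 0 = 1 := by
  simp [sch, schurPoly]

lemma sch_succ (c : ℕ → R) (n : ℕ) : ((n : ℂ) + 1) • sch c (n+1) =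
    ∑ j ∈ Finset.range (n+1), ((j : ℂ) + 1) • (c (j+1) * sch c (n-j)) := by
  have h : ((n : ℂ) + 1) ≠ 0 := by exact_mod_cast Nat.succ_ne_zero n
  simp only [sch]
  rw [schurPoly]
  simp [map_sum, smul_smul, h]

lemma sch_unique (c : ℕ → R) (F : ℕ → R) (h0 : F 0 = 1)
    (h : ∀ n : ℕ, ((n : ℂ) + 1) • F (n+1) =
      ∑ j ∈ Finset.range (n+1), ((j : ℂ) + 1) • (c (j+1) * F (n-j))) (n : ℕ) :
    F n = sch c n := by
  induction n using Nat.strong_induction_on with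
  | _ n ih =>
    cases n with
    | zero => rw [h0, sch_zero]
    | succ n =>
      have hn : ((n : ℂ) + 1) ≠ 0 := by exact_mod_cast Nat.succ_ne_zero n
      have : ((n : ℂ) + 1) • F (n+1) = ((n : ℂ) + 1) • sch c (n+1) := by
        rw [h, sch_succ]
        refine Finset.sum_congr rfl fun j hj => ?_
        rw [ih (n-j) (by omega)]
      have h2 := congrArg (fun x => ((n : ℂ) + 1)⁻¹ • x) this
      simpa [smul_smul, hn] using h2

def Sch (c : ℕ → R) : PowerSeries R := PowerSeries.mk (sch c)
def DD (c : ℕ → R) : PowerSeries R := PowerSeries.mk (fun j => ((j : ℂ) + 1) • c (j+1))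

lemma coeff_DD_mul (c F : ℕ → R) (n : ℕ) : PowerSeries.coeff n (DD c * PowerSeries.mk F) =
    ∑ j ∈ Finset.range (n+1), ((j : ℂ) + 1) • (c (j+1) * F (n-j)) := by
  rw [PowerSeries.coeff_mul, Finset.Nat.sum_antidiagonal_eq_sum_range_succ_mk]
  simp [DD]

lemma coeff_deriv' (F : PowerSeries R) (n : ℕ) :
    PowerSeries.coeff n (PowerSeries.derivative R F) = ((n : ℂ) + 1) • PowerSeries.coeff (n+1) F := by
  rw [PowerSeries.coeff_derivative, Algebra.smul_def, mul_comm]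
  simp

lemma deriv_Sch (c : ℕ → R) : PowerSeries.derivative R (Sch c) = DD c * Sch c := by
  ext n
  rw [coeff_deriv', Sch, coeff_DD_mul, PowerSeries.coeff_mk, sch_succ]

lemma Sch_unique (c : ℕ → R) (F : PowerSeries R) (h0 : PowerSeries.coeff 0 F = 1)
    (h : PowerSeries.derivative R F = DD c * F) : F = Sch c := by
  ext n
  rw [Sch, PowerSeries.coeff_mk]
  refine sch_unique c (fun n => PowerSeries.coeff n F) h0 (fun n => ?_) n
  have hF : F = PowerSeries.mk (fun n => PowerSeries.coeff n F) := by ext n; simp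
  rw [← coeff_deriv', h]
  conv_lhs => rw [hF]
  rw [coeff_DD_mul]

lemma Sch_add (c d : ℕ → R) : Sch c * Sch d = Sch (c + d) := by
  apply Sch_unique
  · simp [Sch, sch_zero]
  · rw [Derivation.leibniz, deriv_Sch, deriv_Sch]
    have : DD (c+d) = DD c + DD d := by ext n; simp [DD]
    rw [this]
    simp only [smul_eq_mul]
    ring

lemma sch_add (c d : ℕ → R) (n : ℕ) :
    sch (c + d) n = ∑ j ∈ Finset.range (n+1), sch c j * sch d (n-j) := by
  have := congrArg (PowerSeries.coeff n) (Sch_add c d)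
  rw [PowerSeries.coeff_mul, Finset.Nat.sum_antidiagonal_eq_sum_range_succ_mk] at this
  simpa [Sch] using this.symm

lemma sch_scale (l : R) (c : ℕ → R) (n : ℕ) :
    sch (fun j => l ^ j * c j) n = l ^ n * sch c n := by
  symm
  refine sch_unique _ (fun n => l ^ n * sch c n) (by simp [sch_zero]) (fun n => ?_) n
  rw [← mul_smul_comm, sch_succ, Finset.mul_sum]
  refine Finset.sum_congr rfl fun j hj => ?_
  have : l ^ (n+1) = l ^ (j+1) * l ^ (n-j) := by
    rw [← pow_add]; congr 1; have := Finset.mem_range.1 hj; omega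
  rw [mul_smul_comm, this]
  congr 1
  ring

lemma sch_zero_fun (n : ℕ) : sch (0 : ℕ → R) n = if n = 0 then 1 else 0 := by
  symm
  refine sch_unique _ (fun n => if n = 0 then (1:R) else 0) (by simp) (fun n => ?_) n
  simp

def cc (n : ℕ) : ℂ := if n = 0 then 1 else 2 * (-1) ^ n

def dd (j : ℕ) : ℂ := if j % 2 = 1 then -(2 / (j : ℂ)) else 0

lemma cc_rec (n : ℕ) : ((n : ℂ) + 1) * cc (n+1) =
    ∑ j ∈ Finset.range (n+1), ((j : ℂ) + 1) * (dd (j+1) * cc (n-j)) := by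
  induction n using Nat.strong_induction_on with
  | _ n ih =>
    match n with
    | 0 => simp [cc, dd]
    | 1 => norm_num [cc, dd, Finset.sum_range_succ]
    | n + 2 =>
      rw [Finset.sum_range_succ', Finset.sum_range_succ']
      have : ∀ j ∈ Finset.range (n+1), (((j + 1 + 1 : ℕ) : ℂ) + 1) * (dd (j+1+1+1) * cc (n+2-(j+1+1)))
        = ((j : ℂ) + 1) * (dd (j+1) * cc (n-j)) := by
        intro j hj
        have h1 : n+2-(j+1+1) = n - j := by omega
        have h2 : (j : ℂ) + 1 ≠ 0 := by exact_mod_cast Nat.succ_ne_zero j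
        have h3 : (j : ℂ) + 1 + 1 + 1 ≠ 0 := by exact_mod_cast Nat.succ_ne_zero (j+2)
        rw [h1, dd, dd, show (j+1+1+1) % 2 = (j+1) % 2 by omega]
        split_ifs
        · push_cast
          field_simp
        · simp
      rw [Finset.sum_congr rfl this, ← ih n (by omega)]
      simp [cc, dd, pow_succ]
      ring

lemma sch_dd (n : ℕ) : sch dd n = cc n := by
  symm
  refine sch_unique _ cc (by simp [cc]) (fun n => ?_) n
  simpa using cc_rec n

lemma map_sch {R' : Type*} [CommRing R'] [Algebra ℂ R'] (f : R →ₐ[ℂ] R') (c : ℕ → R) (n : ℕ) :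
    f (sch c n) = sch (fun j => f (c j)) n := by
  rw [sch, sch, ← AlgHom.comp_apply, MvPolynomial.comp_aeval]

end SchurGen

lemma sTildeZ_nat (n : ℕ) : sTildeZ n = sch tTilde n := by simp [sTildeZ, sch]
lemma sTildeZ_neg {m : ℤ} (h : m < 0) : sTildeZ m = 0 := by simp [sTildeZ, h]

lemma sTilde_orth (N : ℕ) : ∑ a ∈ Finset.range (N+1),
    ((-1 : ℂ) ^ a) • (sTildeZ a * sTildeZ ((N - a : ℕ) : ℤ)) = if N = 0 then 1 else 0 := by
  rw [← sch_zero_fun (R := BRing)]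
  have : (0 : ℕ → BRing) = (fun j => (-1) ^ j * tTilde j) + tTilde := by
    ext1 j
    simp only [Pi.add_apply, Pi.zero_apply, tTilde]
    split_ifs with h
    · rw [Odd.neg_one_pow (Nat.odd_iff.2 h)]; ring
    · simp
  rw [this, sch_add]
  refine Finset.sum_congr rfl fun a ha => ?_
  rw [sch_scale, sTildeZ_nat, sTildeZ_nat, Algebra.smul_def, mul_assoc]
  simp

def SS : BRing →ₐ[ℂ] Polynomial BRing := MvPolynomial.aeval
    (fun i => Polynomial.C (MvPolynomial.X i) -
      Polynomial.C (MvPolynomial.C ((2 : ℂ) / ((2 * i + 1 : ℕ) : ℂ))) *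
        Polynomial.X ^ (2 * i + 1))

lemma shiftMinus_eq (p : BRing) : shiftMinus p = SS p := rfl

def CAlg : BRing →ₐ[ℂ] Polynomial BRing := IsScalarTower.toAlgHom ℂ BRing (Polynomial BRing)

lemma CAlg_apply (p : BRing) : CAlg p = Polynomial.C p := rfl

lemma SS_sch (n : ℕ) : SS (sch tTilde n) =
    ∑ l ∈ Finset.range (n+1), Polynomial.C (cc l • sch tTilde (n-l)) * Polynomial.X ^ l := by
  rw [map_sch]
  have : (fun j => SS (tTilde j)) =
    (fun j => (Polynomial.X : Polynomial BRing) ^ j * Algebra.ofId ℂ (Polynomial BRing) (dd j)) + (fun j => CAlg (tTilde j)) := by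
    ext1 j
    simp only [Pi.add_apply, tTilde, dd]
    split_ifs with h
    · obtain ⟨i, rfl⟩ : ∃ i, j = 2 * i + 1 := ⟨j / 2, by omega⟩
      rw [show (2 * i + 1 - 1)/2 = i by omega]
      simp only [SS, MvPolynomial.aeval_X, CAlg_apply, Algebra.ofId_apply]
      rw [map_neg, IsScalarTower.algebraMap_apply ℂ BRing (Polynomial BRing)]
      simp only [Polynomial.algebraMap_apply, MvPolynomial.algebraMap_eq, Algebra.algebraMap_self, RingHom.id_apply]
      ring
    · simp
  rw [this, sch_add]
  refine Finset.sum_congr rfl fun l hl => ?_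
  rw [sch_scale, ← map_sch, ← map_sch, sch_dd, CAlg_apply, Algebra.ofId_apply, Algebra.smul_def, map_mul,
    IsScalarTower.algebraMap_apply ℂ BRing (Polynomial BRing)]
  simp only [Polynomial.algebraMap_apply, Algebra.algebraMap_self, RingHom.id_apply]
  ring

end

noncomputable section

def TT (j : ℤ) : Polynomial BRing →ₗ[BRing] BRing :=
  Polynomial.lsum (fun k => LinearMap.mulLeft BRing (sTildeZ ((k : ℤ) - j)))

lemma TT_C_mul_X_pow (j : ℤ) (c : BRing) (k : ℕ) :
    TT j (Polynomial.C c * Polynomial.X ^ k) = sTildeZ ((k : ℤ) - j) * c := by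
  rw [TT, Polynomial.C_mul_X_pow_eq_monomial, Polynomial.lsum_apply, Polynomial.sum_monomial_index]
  · simp
  · simp

lemma TT_eq_sum (j : ℤ) (q : Polynomial BRing) :
    TT j q = ∑ k ∈ q.support, sTildeZ ((k : ℤ) - j) * q.coeff k := by
  rw [TT, Polynomial.lsum_apply]; rfl

def Phi (j : ℤ) : BRing →ₗ[ℂ] BRing :=
  sqrt2⁻¹ • ((TT j).restrictScalars ℂ ∘ₗ SS.toLinearMap)

lemma Phi_apply (j : ℤ) (p : BRing) : Phi j p = sqrt2⁻¹ • TT j (SS p) := rfl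

lemma phiHat_eq (j : ℤ) (p : BRing) : phiHat j p = Phi j p := by
  rw [Phi_apply, phiHat, shiftMinus_eq, TT_eq_sum]
  congr 1
  apply finsum_eq_sum_of_support_subset
  intro k hk
  simp only [Function.mem_support] at hk
  simp only [Finset.mem_coe, Polynomial.mem_support_iff]
  intro h
  exact hk (by rw [h, mul_zero])

lemma Phi_large (p : BRing) : ∃ M : ℤ, ∀ j ≥ M, Phi j p = 0 := by
  refine ⟨(SS p).natDegree + 1, fun j hj => ?_⟩
  rw [Phi_apply, TT_eq_sum, Finset.sum_eq_zero, smul_zero]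
  intro k hk
  have := Polynomial.le_natDegree_of_mem_supp k hk
  rw [sTildeZ_neg (by omega), zero_mul]

lemma TT_mul_X_pow (j : ℤ) (q : Polynomial BRing) (k : ℕ) :
    TT j (q * Polynomial.X ^ k) = TT (j - k) q := by
  induction q using Polynomial.induction_on' with
  | add p q hp hq => rw [add_mul, map_add, map_add, hp, hq]
  | monomial n a =>
    rw [← Polynomial.C_mul_X_pow_eq_monomial, mul_assoc, ← pow_add, TT_C_mul_X_pow, TT_C_mul_X_pow]
    congr 2
    push_cast
    ring

lemma Phi_mul_X (j : ℤ) (p : BRing) (i : ℕ) :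
    Phi j (p * MvPolynomial.X i) = Phi j p * MvPolynomial.X i -
      ((2 : ℂ) / ((2 * i + 1 : ℕ) : ℂ)) • Phi (j - (2 * i + 1 : ℕ)) p := by
  have h : SS (p * MvPolynomial.X i) = (MvPolynomial.X i : BRing) • SS p -
      (MvPolynomial.C ((2 : ℂ) / ((2 * i + 1 : ℕ) : ℂ)) : BRing) • (SS p * Polynomial.X ^ (2 * i + 1)) := by
    rw [map_mul]
    conv_lhs => rw [SS, MvPolynomial.aeval_X]
    rw [← SS, Polynomial.smul_eq_C_mul, Polynomial.smul_eq_C_mul]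
    ring
  rw [Phi_apply, h, map_sub, map_smul, map_smul, TT_mul_X_pow, Phi_apply, Phi_apply, smul_sub]
  congr 1
  · rw [smul_eq_mul, mul_comm, smul_mul_assoc]
  · rw [smul_eq_mul, MvPolynomial.C_mul', smul_comm]

lemma Phi_one (j : ℤ) : Phi j 1 = sqrt2⁻¹ • sTildeZ (-j) := by
  have := TT_C_mul_X_pow j 1 0
  rw [Phi_apply, map_one]
  simp at this
  rw [this]

lemma SS_sTilde (m : ℤ) (M : ℕ) (hM : m < M) : SS (sTildeZ m) =
    ∑ l ∈ Finset.range M, Polynomial.C (cc l • sTildeZ (m-l)) * Polynomial.X ^ l := by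
  by_cases h : m < 0
  · rw [sTildeZ_neg h, map_zero, Finset.sum_eq_zero]
    intro l hl
    rw [sTildeZ_neg (by omega)]
    simp
  · obtain ⟨n, rfl⟩ := Int.eq_ofNat_of_zero_le (not_lt.1 h)
    rw [sTildeZ_nat, SS_sch]
    have hs : Finset.range (n+1) ⊆ Finset.range M := by
      intro x hx; simp at *; omega
    rw [← Finset.sum_subset hs]
    · refine Finset.sum_congr rfl fun l hl => ?_
      have := Finset.mem_range.1 hl
      rw [show (n : ℤ) - l = ((n - l : ℕ) : ℤ) by omega, sTildeZ_nat]
    · intro l _ hl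
      rw [sTildeZ_neg (by simp at hl; omega)]
      simp

lemma Phi_sTilde (i m : ℤ) (M : ℕ) (hM : m < M) : Phi i (sTildeZ m) =
    sqrt2⁻¹ • ∑ l ∈ Finset.range M, cc l • (sTildeZ (l - i) * sTildeZ (m - l)) := by
  rw [Phi_apply, SS_sTilde m M hM, map_sum]
  congr 1
  refine Finset.sum_congr rfl fun l _ => ?_
  rw [TT_C_mul_X_pow, mul_smul_comm]

lemma sym_sum (g : ℤ → BRing) (M : ℕ) :
    ∑ l ∈ Finset.range (M+1), cc l • (g l + g (-l)) =
      (2 : ℂ) • ∑ u ∈ Finset.Icc (-M : ℤ) M, ((-1 : ℂ) ^ u) • g u := by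
  induction M with
  | zero => simp [cc, two_smul]
  | succ M ih =>
    rw [Finset.sum_range_succ, ih]
    have : Finset.Icc (-(M+1 : ℕ) : ℤ) (M+1 : ℕ) =
      insert (-(M+1 : ℕ) : ℤ) (insert ((M+1 : ℕ) : ℤ) (Finset.Icc (-M : ℤ) M)) := by
      ext x; simp; omega
    rw [this, Finset.sum_insert (by simp; omega), Finset.sum_insert (by simp)]
    have h1 : ((-1 : ℂ) ^ (-(M+1 : ℕ) : ℤ)) = (-1) ^ (M+1) := by
      rw [zpow_neg, zpow_natCast, ← inv_pow]; norm_num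
    rw [h1, zpow_natCast]
    simp only [cc, Nat.succ_ne_zero, if_false, mul_smul, smul_add]
    simp
    abel

lemma sqrt2_sq : sqrt2⁻¹ * sqrt2⁻¹ = (2 : ℂ)⁻¹ := by
  rw [← mul_inv, sqrt2, ← Complex.ofReal_mul, Real.mul_self_sqrt (by norm_num)]
  norm_num

lemma sum_orth (i j : ℤ) (M : ℕ) (h1 : |i| ≤ M) (h2 : |j| ≤ M) :
    ∑ u ∈ Finset.Icc (-M : ℤ) M, ((-1 : ℂ) ^ u) • (sTildeZ (u - i) * sTildeZ (-j - u)) =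
      if i + j = 0 then ((-1 : ℂ) ^ i) • (1 : BRing) else 0 := by
  rw [abs_le] at h1 h2
  by_cases hN : 0 < i + j
  · rw [if_neg hN.ne', Finset.sum_eq_zero]
    intro u _
    by_cases hu : u - i < 0
    · rw [sTildeZ_neg hu]; simp
    · rw [sTildeZ_neg (m := -j-u) (by omega)]; simp
  · obtain ⟨N, hN⟩ : ∃ N : ℕ, (N : ℤ) = -i - j := ⟨(-i-j).toNat, by omega⟩
    have := sTilde_orth N
    have h3 := congrArg (fun x => ((-1 : ℂ) ^ i) • x) this
    simp only [Finset.smul_sum] at h3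
    have h4 : (if i + j = 0 then ((-1 : ℂ) ^ i) • (1 : BRing) else 0) =
      ((-1 : ℂ) ^ i) • (if N = 0 then (1 : BRing) else 0) := by
      by_cases h : N = 0
      · rw [if_pos h, if_pos (by omega)]
      · rw [if_neg h, if_neg (by omega), smul_zero]
    rw [h4, ← h3]
    symm
    have hinj : Function.Injective (fun a : ℕ => (a : ℤ) + i) := by
      intro a b hab; simpa using hab
    have hsub : (Finset.range (N+1)).map ⟨_, hinj⟩ ⊆ Finset.Icc (-M : ℤ) M := by
      intro x hx
      simp at hx ⊢
      obtain ⟨a, ha, rfl⟩ := hx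
      omega
    rw [← Finset.sum_subset hsub, Finset.sum_map]
    · refine Finset.sum_congr rfl fun a ha => ?_
      have := Finset.mem_range.1 ha
      simp only [Function.Embedding.coeFn_mk]
      rw [smul_smul, zpow_add₀ (by norm_num), zpow_natCast, mul_comm]
      congr 3 <;> omega
    · intro u _ hu
      by_cases hu' : u - i < 0
      · rw [sTildeZ_neg hu']; simp
      · rw [sTildeZ_neg (m := -j-u)]
        · simp
        by_contra hc
        apply hu
        simp
        exact ⟨(u-i).toNat, by omega, by omega⟩

lemma anti_one (i j : ℤ) : Phi i (Phi j 1) + Phi j (Phi i 1) =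
    if i + j = 0 then ((-1 : ℂ) ^ i) • (1 : BRing) else 0 := by
  set M : ℕ := i.natAbs + j.natAbs with hM
  rw [Phi_one, Phi_one, map_smul, map_smul, Phi_sTilde i (-j) (M+1) (by omega),
    Phi_sTilde j (-i) (M+1) (by omega), ← smul_add, ← smul_add, ← Finset.sum_add_distrib, smul_smul,
    sqrt2_sq, ← sum_orth i j M (by rw [abs_le]; omega) (by rw [abs_le]; omega)]
  have := sym_sum (fun u => sTildeZ (u - i) * sTildeZ (-j - u)) M
  have h2 : ∀ l : ℕ, cc l • (sTildeZ (l - i) * sTildeZ (-j - l)) + cc l • (sTildeZ (l - j) * sTildeZ (-i - l))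
    = cc l • (sTildeZ (l - i) * sTildeZ (-j - l) + sTildeZ (-l - i) * sTildeZ (-j - -l)) := by
    intro l
    rw [← smul_add, mul_comm (sTildeZ (l - j)), show -(l : ℤ) - i = -i - l by ring,
      show -j - -(l : ℤ) = l - j by ring]
  simp only [h2]
  rw [this, smul_smul]
  norm_num

lemma anti (i j : ℤ) (p : BRing) : Phi i (Phi j p) + Phi j (Phi i p) =
    if i + j = 0 then ((-1 : ℂ) ^ i) • p else 0 := by
  induction p using MvPolynomial.induction_on generalizing i j with
  | C a =>
    have h := congrArg (fun x => a • x) (anti_one i j)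
    have : (MvPolynomial.C a : BRing) = a • 1 := by rw [MvPolynomial.smul_eq_C_mul, mul_one]
    rw [this]
    simp only [map_smul]
    rw [← smul_add, anti_one]
    split_ifs
    · rw [smul_comm]
    · rw [smul_zero]
  | add p q hp hq =>
    simp only [map_add]
    rw [add_add_add_comm, hp, hq]
    split_ifs
    · rw [smul_add]
    · simp
  | mul_X p n hp =>
    simp only [Phi_mul_X, map_sub, map_smul]
    set k : ℤ := ((2 * n + 1 : ℕ) : ℤ) with hk
    set r : ℂ := (2 : ℂ) / ((2 * n + 1 : ℕ) : ℂ)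
    have e1 := hp i j
    have e2 := hp (i-k) j
    have e3 := hp i (j-k)
    have h : (if i - k + j = 0 then ((-1 : ℂ) ^ (i-k)) • p else 0) +
        (if i + (j - k) = 0 then ((-1 : ℂ) ^ i) • p else 0) = 0 := by
      by_cases h : i + j = k
      · rw [if_pos (by omega), if_pos (by omega), zpow_sub₀ (by norm_num), hk, zpow_natCast,
          Odd.neg_one_pow ⟨n, rfl⟩, ← add_smul, div_neg, div_one, neg_add_cancel, zero_smul]
      · rw [if_neg (by omega), if_neg (by omega), add_zero]
    have e4 : (if i + j = 0 then ((-1 : ℂ) ^ i) • (p * MvPolynomial.X n) else 0) =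
      (if i + j = 0 then ((-1 : ℂ) ^ i) • p else 0) * (MvPolynomial.X n : BRing) := by
      split_ifs <;> simp
    rw [e4, ← e1]
    rw [← e2, ← e3] at h
    have h' := congrArg (fun x => r • x) h
    simp only [smul_add, smul_zero] at h'
    linear_combination (exp := 1) -h'

lemma vOp_eq (a : ℤ → ℂ) (p : BRing) (N M : ℤ) (hN : ∀ j < N, a j = 0)
    (hM : ∀ j ≥ M, Phi j p = 0) : vOp a p = ∑ j ∈ Finset.Ico N M, a j • Phi j p := by
  rw [vOp]
  simp only [phiHat_eq]
  apply finsum_eq_sum_of_support_subset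
  intro j hj
  simp only [Function.mem_support] at hj
  simp only [Finset.coe_Ico, Set.mem_Ico]
  constructor
  · by_contra h; exact hj (by rw [hN j (by omega), zero_smul])
  · by_contra h; exact hj (by rw [hM j (by omega), smul_zero])

lemma vOp_add (a : ℤ → ℂ) (ha : BddBelowSupport a) (p q : BRing) :
    vOp a (p + q) = vOp a p + vOp a q := by
  obtain ⟨N, hN⟩ := ha
  obtain ⟨M1, h1⟩ := Phi_large p
  obtain ⟨M2, h2⟩ := Phi_large q
  have h1' : ∀ j ≥ max M1 M2, Phi j p = 0 := fun j hj => h1 j (by omega)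
  have h2' : ∀ j ≥ max M1 M2, Phi j q = 0 := fun j hj => h2 j (by omega)
  rw [vOp_eq a p N _ hN h1', vOp_eq a q N _ hN h2',
    vOp_eq a (p+q) N (max M1 M2) hN (fun j hj => by rw [map_add, h1' j hj, h2' j hj, add_zero]),
    ← Finset.sum_add_distrib]
  simp only [map_add, smul_add]

lemma vOp_smul (a : ℤ → ℂ) (ha : BddBelowSupport a) (c : ℂ) (p : BRing) :
    vOp a (c • p) = c • vOp a p := by
  obtain ⟨N, hN⟩ := ha
  obtain ⟨M1, h1⟩ := Phi_large p
  rw [vOp_eq a p N _ hN h1,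
    vOp_eq a (c • p) N M1 hN (fun j hj => by rw [map_smul, h1 j hj, smul_zero]),
    Finset.smul_sum]
  refine Finset.sum_congr rfl fun j _ => ?_
  rw [map_smul, smul_comm]

def VL (a : ℤ → ℂ) (ha : BddBelowSupport a) : BRing →ₗ[ℂ] BRing where
  toFun := vOp a
  map_add' := vOp_add a ha
  map_smul' := vOp_smul a ha

lemma anti_vOp (j : ℤ) (a : ℤ → ℂ) (ha : BddBelowSupport a) (p : BRing) :
    Phi j (vOp a p) = ((-1 : ℂ) ^ j * a (-j)) • p - vOp a (Phi j p) := by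
  obtain ⟨N, hN⟩ := ha
  obtain ⟨M1, h1⟩ := Phi_large p
  obtain ⟨M2, h2⟩ := Phi_large (Phi j p)
  set M := max (max M1 M2) (-j + 1)
  rw [vOp_eq a p N M hN (fun j hj => h1 j (by omega)),
    vOp_eq a (Phi j p) N M hN (fun j hj => h2 j (by omega)), eq_sub_iff_add_eq, map_sum,
    ← Finset.sum_add_distrib]
  simp only [map_smul, ← smul_add, anti]
  by_cases h : -j < N
  · rw [hN _ h, mul_zero, zero_smul, Finset.sum_eq_zero]
    intro x hx
    rw [if_neg, smul_zero]
    simp at hx; omega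
  · rw [Finset.sum_eq_single (-j)]
    · simp [smul_smul, mul_comm]
    · intro b _ hb
      rw [if_neg (by omega), smul_zero]
    · intro hb; exfalso; apply hb; simp; omega

lemma ev0_sTilde (m : ℤ) : ev0 (sTildeZ m) = if m = 0 then 1 else 0 := by
  by_cases h : m < 0
  · rw [sTildeZ_neg h, if_neg h.ne]; simp [ev0]
  · obtain ⟨n, rfl⟩ := Int.eq_ofNat_of_zero_le (not_lt.1 h)
    rw [sTildeZ_nat]
    have := map_sch (MvPolynomial.aeval (fun _ => (0:ℂ)) : BRing →ₐ[ℂ] ℂ) tTilde n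
    have h2 : (fun j => (MvPolynomial.aeval (fun _ => (0:ℂ)) : BRing →ₐ[ℂ] ℂ) (tTilde j)) = 0 := by
      ext j; simp only [tTilde]; split_ifs <;> simp
    rw [h2, sch_zero_fun] at this
    simp only [ev0]
    rw [MvPolynomial.aeval_eq_eval] at this
    simp at this ⊢
    exact this

def ev0L : BRing →ₗ[ℂ] ℂ := (MvPolynomial.aeval (fun _ => (0:ℂ)) : BRing →ₐ[ℂ] ℂ).toLinearMap

lemma ev0L_apply (p : BRing) : ev0 p = ev0L p := by
  simp [ev0, ev0L]

lemma ev0_Phi_neg (j : ℤ) (hj : j < 0) (p : BRing) : ev0 (Phi j p) = 0 := by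
  rw [Phi_apply, ev0L_apply, map_smul, TT_eq_sum, map_sum, Finset.sum_eq_zero, smul_zero]
  intro k _
  rw [← ev0L_apply, ev0, map_mul]
  change ev0 _ * _ = 0
  rw [ev0_sTilde, if_neg (by omega), zero_mul]

lemma SS_coeff_zero (p : BRing) : (SS p).coeff 0 = p := by
  induction p using MvPolynomial.induction_on with
  | C a =>
    have : (MvPolynomial.C a : BRing) = a • 1 := by rw [MvPolynomial.smul_eq_C_mul, mul_one]
    rw [this, map_smul, map_one]; simp
  | add p q hp hq => rw [map_add, Polynomial.coeff_add, hp, hq]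
  | mul_X p n hp =>
    rw [map_mul, Polynomial.mul_coeff_zero, hp]
    congr 1
    rw [SS, MvPolynomial.aeval_X]
    simp

lemma ev0_Phi_zero (p : BRing) : ev0 (Phi 0 p) = sqrt2⁻¹ * ev0 p := by
  rw [Phi_apply, ev0L_apply, map_smul, TT_eq_sum, map_sum, smul_eq_mul]
  congr 1
  rw [Finset.sum_eq_single 0]
  · rw [← ev0L_apply, SS_coeff_zero, ev0, map_mul]
    change ev0 _ * _ = _
    rw [ev0_sTilde]; simp
  · intro k _ hk
    rw [← ev0L_apply, ev0, map_mul]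
    change ev0 _ * _ = 0
    rw [ev0_sTilde, if_neg (by omega), zero_mul]
  · intro h
    rw [Polynomial.notMem_support_iff.1 h]; simp

lemma Phi_one_pos (j : ℤ) (hj : 0 < j) : Phi j 1 = 0 := by
  rw [Phi_one, sTildeZ_neg (by omega), smul_zero]

lemma Phi_one_zero : Phi 0 1 = sqrt2⁻¹ • 1 := by
  rw [Phi_one]
  have := sTildeZ_nat 0
  rw [sch_zero] at this
  simp at this
  simp [this]

end

noncomputable section

def insP {m : ℕ} (k : Fin (m+1)) (τ : Equiv.Perm (Fin m)) : Equiv.Perm (Fin (m+1)) :=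
  k.cycleRange.symm * Equiv.Perm.decomposeFin.symm (0, τ)

lemma insP_zero {m : ℕ} (k : Fin (m+1)) (τ : Equiv.Perm (Fin m)) : insP k τ 0 = k := by
  simp [insP]

lemma insP_succ {m : ℕ} (k : Fin (m+1)) (τ : Equiv.Perm (Fin m)) (i : Fin m) :
    insP k τ i.succ = k.succAbove (τ i) := by
  simp [insP]

lemma sign_insP {m : ℕ} (k : Fin (m+1)) (τ : Equiv.Perm (Fin m)) :
    (Equiv.Perm.sign (insP k τ) : ℤ) = (-1) ^ (k : ℕ) * Equiv.Perm.sign τ := by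
  rw [insP, Equiv.Perm.sign_mul, Equiv.Perm.sign_symm, Fin.sign_cycleRange,
    Equiv.Perm.decomposeFin.symm_sign]
  simp

lemma insP_bij (m : ℕ) : Function.Bijective
    (fun x : Fin (m+1) × Equiv.Perm (Fin m) => insP x.1 x.2) := by
  rw [Fintype.bijective_iff_injective_and_card]
  constructor
  · rintro ⟨k, τ⟩ ⟨k', τ'⟩ h
    simp only at h
    have h0 : k = k' := by rw [← insP_zero k τ, h, insP_zero]
    subst h0
    congr 1
    ext1 i
    have := insP_succ k τ i
    rw [h, insP_succ] at this
    exact (Fin.succAbove_right_injective this).symm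
  · exact (Fintype.card_congr Equiv.Perm.decomposeFin).symm

lemma sum_insP {m : ℕ} {R : Type*} [AddCommMonoid R] (F : Equiv.Perm (Fin (m+1)) → R) :
    ∑ σ, F σ = ∑ k, ∑ τ, F (insP k τ) := by
  rw [← Fintype.sum_prod_type']
  exact (Fintype.sum_bijective _ (insP_bij m) _ _ (fun _ => rfl)).symm

def ev {n : ℕ} (i : Fin n) : Fin (2 * n) := ⟨2 * i.val, by omega⟩
def od {n : ℕ} (i : Fin n) : Fin (2 * n) := ⟨2 * i.val + 1, by omega⟩

def pfC {n : ℕ} (σ : Equiv.Perm (Fin (2 * n))) : Prop :=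
  (∀ i : Fin n, σ (ev i) < σ (od i)) ∧ (∀ i j : Fin n, i < j → σ (ev i) < σ (ev j))

open scoped Classical in
def pf {R : Type*} [CommRing R] {n : ℕ} (f : Fin (2 * n) → Fin (2 * n) → R) : R :=
  ∑ σ : Equiv.Perm (Fin (2 * n)), if pfC σ then
    (Equiv.Perm.sign σ : ℤ) • ∏ i : Fin n, f (σ (ev i)) (σ (od i)) else 0

lemma pfaffian_eq {R : Type*} [CommRing R] {n : ℕ} (f : Fin (2 * n) → Fin (2 * n) → R) :
    pfaffian (skewOf f) = pf f := by
  have hn : 2 * n / 2 = n := by omega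
  have hc : ∀ σ : Equiv.Perm (Fin (2 * n)), pfaffianCond σ ↔ pfC σ := by
    intro σ
    constructor
    · rintro ⟨h1, h2⟩
      exact ⟨fun i => h1 (Fin.cast hn.symm i),
        fun i j hij => h2 (Fin.cast hn.symm i) (Fin.cast hn.symm j) hij⟩
    · rintro ⟨h1, h2⟩
      exact ⟨fun i => h1 (Fin.cast hn i),
        fun i j hij => h2 (Fin.cast hn i) (Fin.cast hn j) hij⟩
  rw [pfaffian, pf]
  refine Finset.sum_congr rfl fun σ _ => ?_
  by_cases h : pfC σ
  · rw [if_pos h, if_pos ((hc σ).2 h)]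
    congr 1
    refine Fintype.prod_equiv (finCongr hn) _ _ fun i => ?_
    have := h.1 (finCongr hn i)
    rw [skewOf, Matrix.of_apply]
    exact if_pos this
  · rw [if_neg h, if_neg (fun h' => h ((hc σ).1 h'))]

lemma pfC_zero {n : ℕ} (σ : Equiv.Perm (Fin (2 * (n+1)))) (h : pfC σ) :
    σ (ev 0) = ev 0 := by
  obtain ⟨x, hx⟩ := σ.surjective (ev 0)
  have hz : ∀ y : Fin (2 * (n+1)), ¬ y < ev 0 := by
    intro y hy; rw [Fin.lt_def] at hy; simp [ev] at hy
  rcases Nat.even_or_odd' x.val with ⟨c, hc | hc⟩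
  · have hcn : c < n + 1 := by omega
    have hx' : x = ev ⟨c, hcn⟩ := by ext; simp [ev, hc]
    by_cases h0 : c = 0
    · subst h0; have e : x = ev 0 := hx'; rw [← e, hx, e]
    · have := h.2 0 ⟨c, hcn⟩ (by rw [Fin.lt_def]; simp; omega)
      rw [← hx', hx] at this
      exact absurd this (hz _)
  · have hcn : c < n + 1 := by omega
    have hx' : x = od ⟨c, hcn⟩ := by ext; simp [od, hc]
    have := h.1 ⟨c, hcn⟩
    rw [← hx', hx] at this
    exact absurd this (hz _)

def up {n : ℕ} (k : Fin (2 * n + 1)) (i : Fin (2 * n)) : Fin (2 * (n+1)) := (k.succAbove i).succ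

def in2 {n : ℕ} (k : Fin (2 * n + 1)) (τ : Equiv.Perm (Fin (2 * n))) :
    Equiv.Perm (Fin (2 * (n+1))) :=
  insP (m := 2 * n + 1) 0 (insP k τ)

lemma up_lt {n : ℕ} (k : Fin (2 * n + 1)) (i j : Fin (2 * n)) : up k i < up k j ↔ i < j := by
  unfold up
  exact (Fin.succ_lt_succ_iff (a := k.succAbove i) (b := k.succAbove j)).trans
    Fin.succAbove_lt_succAbove_iff

lemma in2_ev0 {n : ℕ} (k : Fin (2 * n + 1)) (τ : Equiv.Perm (Fin (2 * n))) :
    in2 k τ (ev 0) = ev 0 := insP_zero (m := 2 * n + 1) 0 (insP k τ)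

lemma in2_od0 {n : ℕ} (k : Fin (2 * n + 1)) (τ : Equiv.Perm (Fin (2 * n))) :
    in2 k τ (od 0) = k.succ := by
  have := insP_succ (m := 2 * n + 1) 0 (insP k τ) 0
  rw [insP_zero, Fin.succAbove_zero] at this
  exact this

lemma in2_succ {n : ℕ} (k : Fin (2 * n + 1)) (τ : Equiv.Perm (Fin (2 * n))) (i : Fin (2 * n)) :
    in2 k τ i.succ.succ = up k (τ i) := by
  have := insP_succ (m := 2 * n + 1) 0 (insP k τ) i.succ
  rw [Fin.succAbove_zero, insP_succ k τ i] at this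
  exact this

lemma in2_ev {n : ℕ} (k : Fin (2 * n + 1)) (τ : Equiv.Perm (Fin (2 * n))) (i : Fin n) :
    in2 k τ (ev i.succ) = up k (τ (ev i)) := by
  rw [← in2_succ]; congr 1

lemma in2_od {n : ℕ} (k : Fin (2 * n + 1)) (τ : Equiv.Perm (Fin (2 * n))) (i : Fin n) :
    in2 k τ (od i.succ) = up k (τ (od i)) := by
  rw [← in2_succ]; congr 1

lemma pfC_in2 {n : ℕ} (k : Fin (2 * n + 1)) (τ : Equiv.Perm (Fin (2 * n))) :
    pfC (in2 k τ) ↔ pfC τ := by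
  constructor
  · rintro ⟨h1, h2⟩
    refine ⟨fun i => ?_, fun i j hij => ?_⟩
    · have := h1 i.succ
      rwa [in2_ev, in2_od, up_lt] at this
    · have := h2 i.succ j.succ (Fin.succ_lt_succ_iff.2 hij)
      rwa [in2_ev, in2_ev, up_lt] at this
  · rintro ⟨h1, h2⟩
    refine ⟨fun i => ?_, fun i j hij => ?_⟩
    · induction i using Fin.cases with
      | zero => rw [in2_ev0, in2_od0]; exact Fin.succ_pos k
      | succ i => rw [in2_ev, in2_od, up_lt]; exact h1 i
    · induction j using Fin.cases with
      | zero => exact absurd hij (Fin.not_lt_zero i)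
      | succ j =>
        induction i using Fin.cases with
        | zero => rw [in2_ev0, in2_ev]; exact Fin.succ_pos _
        | succ i => rw [in2_ev, in2_ev, up_lt]; exact h2 i j (Fin.succ_lt_succ_iff.1 hij)

lemma sign_in2 {n : ℕ} (k : Fin (2 * n + 1)) (τ : Equiv.Perm (Fin (2 * n))) :
    (Equiv.Perm.sign (in2 k τ) : ℤ) = (-1) ^ (k : ℕ) * Equiv.Perm.sign τ := by
  have := sign_insP (m := 2 * n + 1) 0 (insP k τ)
  rw [sign_insP k τ, Fin.val_zero, pow_zero, one_mul] at this
  exact this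

lemma pf_expand {R : Type*} [CommRing R] {n : ℕ}
    (f : Fin (2 * (n+1)) → Fin (2 * (n+1)) → R) :
    pf f = ∑ k : Fin (2 * n + 1), (-1) ^ (k : ℕ) * f (ev 0) k.succ *
      pf (fun i j => f (up k i) (up k j)) := by
  classical
  rw [pf]
  refine (sum_insP (m := 2 * n + 1) _).trans ?_
  rw [Finset.sum_eq_single 0]
  · rw [sum_insP]
    refine Finset.sum_congr rfl fun k _ => ?_
    rw [pf, Finset.mul_sum]
    refine Finset.sum_congr rfl fun τ _ => ?_
    change (if pfC (in2 k τ) then (Equiv.Perm.sign (in2 k τ) : ℤ) •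
      ∏ i : Fin (n+1), f (in2 k τ (ev i)) (in2 k τ (od i)) else 0) = _
    by_cases h : pfC τ
    · rw [if_pos h, if_pos ((pfC_in2 k τ).2 h), Fin.prod_univ_succ, in2_ev0, in2_od0, sign_in2]
      simp only [in2_ev, in2_od, zsmul_eq_mul]
      push_cast
      ring
    · rw [if_neg h, if_neg (fun h' => h ((pfC_in2 k τ).1 h')), mul_zero]
  · intro k _ hk
    refine Finset.sum_eq_zero fun τ _ => ?_
    refine if_neg fun h => hk ?_
    have h1 := pfC_zero (n := n) (insP (m := 2 * n + 1) k τ) h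
    exact (insP_zero (m := 2 * n + 1) k τ).symm.trans h1
  · simp

lemma pf_zero {R : Type*} [CommRing R] (f : Fin (2 * 0) → Fin (2 * 0) → R) : pf f = 1 := by
  classical
  have : ∀ σ : Equiv.Perm (Fin (2 * 0)), pfC σ := fun σ => ⟨fun i => i.elim0, fun i => i.elim0⟩
  rw [pf]
  simp only [this, if_true]
  rw [Fintype.sum_eq_single 1]
  · simp
  · intro x hx
    exact absurd (Equiv.ext fun i => (Nat.not_lt_zero _ i.2).elim) hx

end

noncomputable section

def st {m : ℕ} (a : Fin m → ℤ → ℂ) : BRing :=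
  (List.ofFn fun i => vOp (a i)).foldr (fun f x => f x) 1

lemma st_succ {m : ℕ} (a : Fin (m+1) → ℤ → ℂ) :
    st a = vOp (a 0) (st (fun i => a i.succ)) := by
  simp [st, List.ofFn_succ]

lemma st_zero (a : Fin 0 → ℤ → ℂ) : st a = 1 := by simp [st]

lemma Phi_st {m : ℕ} (a : Fin (m+1) → ℤ → ℂ) (ha : ∀ i, BddBelowSupport (a i))
    (j : ℤ) (e : ℂ) (he : Phi j 1 = e • 1) :
    Phi j (st a) = ∑ k : Fin (m+1), ((-1 : ℂ) ^ (k : ℕ) * ((-1 : ℂ) ^ j * a k (-j))) •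
      st (fun i => a (k.succAbove i)) + ((-1 : ℂ) ^ (m+1) * e) • st a := by
  induction m with
  | zero =>
    rw [st_succ, st_zero, anti_vOp j _ (ha 0), he, vOp_smul _ (ha 0)]
    simp [st_zero, sub_eq_add_neg]
  | succ m ih =>
    rw [st_succ, anti_vOp j _ (ha 0), ih _ (fun i => ha _)]
    change _ - VL (a 0) (ha 0) _ = _
    rw [map_add, map_sum, Fin.sum_univ_succ (n := m + 1)]
    simp only [map_smul]
    change _ - (_ + _ • vOp _ _) = _
    rw [← st_succ a]
    have h1 : ∀ k : Fin (m+1), VL (a 0) (ha 0) (st (fun i => a (k.succAbove i).succ)) =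
        st (fun i => a (k.succ.succAbove i)) := by
      intro k
      rw [st_succ (fun i => a (k.succ.succAbove i))]
      simp only [Fin.succ_succAbove_zero, Fin.succ_succAbove_succ]
      rfl
    simp only [h1, Fin.val_zero, pow_zero, one_mul, Fin.val_succ, pow_succ, mul_neg, neg_mul,
      mul_one, neg_smul, Fin.succAbove_zero, Finset.sum_neg_distrib, neg_neg]
    abel

lemma wick_phi {n : ℕ} (b : Fin (2 * n + 1) → ℤ → ℂ) (hb : ∀ i, BddBelowSupport (b i)) (j : ℤ) :
    ev0 (Phi j (st b)) = ∑ k : Fin (2 * n + 1), (-1 : ℂ) ^ (k : ℕ) *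
      ev0 (Phi j (vOp (b k) 1)) * ev0 (st (fun i => b (k.succAbove i))) := by
  rcases lt_trichotomy j 0 with hj | hj | hj
  · simp [ev0_Phi_neg j hj]
  · subst hj
    have h2 : ∀ k, ev0 (Phi 0 (vOp (b k) 1)) = b k 0 / 2 := by
      intro k
      have h := anti_vOp 0 (b k) (hb k) 1
      rw [Phi_one_zero, vOp_smul _ (hb k)] at h
      have h' := congrArg ev0L h
      rw [map_sub, map_smul, map_smul, ← ev0L_apply, ← ev0L_apply, ← ev0L_apply,
        smul_eq_mul, smul_eq_mul, ← ev0_Phi_zero] at h'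
      simp only [ev0, map_one, neg_zero, zpow_zero] at h' ⊢
      linear_combination h' / 2
    have h := Phi_st b hb 0 _ Phi_one_zero
    have h' := congrArg ev0L h
    rw [map_add, map_smul, map_sum, ← ev0L_apply (Phi 0 (st b)), ← ev0L_apply (st b), smul_eq_mul,
      Odd.neg_one_pow ⟨n, rfl⟩, mul_assoc, ← ev0_Phi_zero] at h'
    have h3 : ev0 (Phi 0 (st b)) = (∑ k : Fin (2 * n + 1),
      ev0L (((-1 : ℂ) ^ (k : ℕ) * ((-1 : ℂ) ^ (0 : ℤ) * b k (-0))) •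
      st (fun i => b (k.succAbove i)))) / 2 := by linear_combination h' / 2
    rw [h3, Finset.sum_div]
    refine Finset.sum_congr rfl fun k _ => ?_
    rw [h2, map_smul, ← ev0L_apply, smul_eq_mul, neg_zero, zpow_zero]
    ring
  · have h2 : ∀ k, ev0 (Phi j (vOp (b k) 1)) = (-1 : ℂ) ^ j * b k (-j) := by
      intro k
      have h := anti_vOp j (b k) (hb k) 1
      have h0 : vOp (b k) 0 = 0 := map_zero (VL (b k) (hb k))
      rw [Phi_one_pos j hj, h0, sub_zero] at h
      rw [h, ev0L_apply, map_smul, ← ev0L_apply]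
      simp [ev0]
    have h := Phi_st b hb j 0 (by rw [Phi_one_pos j hj, zero_smul])
    rw [mul_zero, zero_smul, add_zero] at h
    rw [h, ev0L_apply, map_sum]
    refine Finset.sum_congr rfl fun k _ => ?_
    rw [h2, map_smul, ← ev0L_apply, smul_eq_mul]

lemma wick_step {n : ℕ} (c : ℤ → ℂ) (hc : BddBelowSupport c)
    (b : Fin (2 * n + 1) → ℤ → ℂ) (hb : ∀ i, BddBelowSupport (b i)) :
    ev0 (vOp c (st b)) = ∑ k : Fin (2 * n + 1), (-1 : ℂ) ^ (k : ℕ) *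
      ev0 (vOp c (vOp (b k) 1)) * ev0 (st (fun i => b (k.succAbove i))) := by
  obtain ⟨N, hN⟩ := hc
  obtain ⟨M0, h0⟩ := Phi_large (st b)
  choose M1 h1 using fun k => Phi_large (vOp (b k) 1)
  obtain ⟨M2, h2⟩ := (Set.finite_range M1).bddAbove
  have h2' : ∀ k, M1 k ≤ M2 := fun k => h2 ⟨k, rfl⟩
  set M := max M0 M2
  have key : ∀ p : BRing, (∀ j ≥ M, Phi j p = 0) →
      ev0 (vOp c p) = ∑ j ∈ Finset.Ico N M, c j * ev0 (Phi j p) := by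
    intro p hp
    rw [vOp_eq c p N M hN hp, ev0L_apply, map_sum]
    simp only [map_smul, smul_eq_mul, ev0L_apply]
  rw [key _ (fun j hj => h0 j (by omega))]
  simp only [wick_phi b hb, Finset.mul_sum]
  rw [Finset.sum_comm]
  refine Finset.sum_congr rfl fun k _ => ?_
  rw [key _ (fun j hj => h1 k j (by have := h2' k; omega)), Finset.mul_sum, Finset.sum_mul]
  refine Finset.sum_congr rfl fun j _ => ?_
  ring

lemma wick_pf (n : ℕ) (a : Fin (2 * n) → ℤ → ℂ) (ha : ∀ i, BddBelowSupport (a i)) :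
    ev0 (st a) = pf (fun i j : Fin (2 * n) => ev0 (vOp (a i) (vOp (a j) 1))) := by
  induction n with
  | zero =>
    rw [pf_zero]
    have : st a = 1 := by simp [st]
    rw [this]; simp [ev0]
  | succ n ih =>
    rw [pf_expand]
    have h := st_succ (m := 2 * n + 1) a
    rw [show st a = _ from h]
    rw [wick_step (n := n) _ (ha _) _ (fun i => ha _)]
    refine Finset.sum_congr rfl fun k _ => ?_
    rw [← ih (fun i => a (up k i)) (fun i => ha _)]
    rfl

/-- Wick/Pfaffian formula for vacuum expectation values. -/
theorem wick_pfaffian (n : ℕ) (a : Fin (2 * n) → ℤ → ℂ)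
    (ha : ∀ i, BddBelowSupport (a i)) :
    ev0 ((List.ofFn fun i => vOp (a i)).foldr (fun f x => f x) 1) =
      pfaffian (skewOf fun i j : Fin (2 * n) => ev0 (vOp (a i) (vOp (a j) 1))) := by
  rw [pfaffian_eq]
  exact wick_pf n a ha

end
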